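/- For any natural numbers a, b and any finite multiset M of natural numbers, the polynomial C̃_{a,M,b}(q,t) = Σ_{P ∈ L_{a,M,b}} q^{area(P)} t^{depth(P)} is symmetric in q and t, i.e., C̃_{a,M,b}(q,t) = C̃_{a,M,b}(t,q). -/

import Mathlib

/-! ## Plane trees -/

/-- A plane tree: a root together with an ordered (left-to-right) list of subtrees.
A node is a *leaf* if it has no children, and *internal* otherwise. -/
inductive PTree : Type where
  | node : List PTree → PTree


namespace Luka

/-! ## Łukasiewicz paths

A path is encoded by its list of step increments: the step `(1,k)` (an up-step `U_k` of
degree `k`) is encoded by `k : ℤ` with `k ≥ 0`, and the down step `D = (1,-1)` by `-1`. -/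

/-- `P` is a Łukasiewicz path: it is nonempty, uses steps `(1,k)` with `k ≥ -1`,
stays (weakly) above the `x`-axis before its last step, and ends at height `-1`
(so that it goes strictly below the axis only at the last step, which is forced
to be the down-step `D`). -/
def IsLukas (P : List ℤ) : Prop :=
  P ≠ [] ∧ (∀ s ∈ P, -1 ≤ s) ∧ (∀ n, n < P.length → 0 ≤ (P.take n).sum) ∧ P.sum = -1

/-- The degrees of the up-steps of `P`, from left to right (the *profile* of `P`). -/
def upDegs (P : List ℤ) : List ℕ := (P.filter (fun s => 0 ≤ s)).map Int.toNat

/-- The profile multiset `𝔐(P)`: the multiset of degrees of the up-steps of `P`. -/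
def profileM (P : List ℤ) : Multiset ℕ := (upDegs P : Multiset ℕ)

/-- The degree of the first up-step of `P`, if any. -/
def firstUp? (P : List ℤ) : Option ℕ := (upDegs P).head?

/-- The degree of the last up-step of `P`, if any. -/
def lastUp? (P : List ℤ) : Option ℕ := (upDegs P).getLast?

/-- Auxiliary: starting from height `h`, record the starting height of every up-step. -/
def areaVecAux : ℤ → List ℤ → List ℤ
  | _, [] => []
  | h, s :: rest => (if 0 ≤ s then [h] else []) ++ areaVecAux (h + s) rest

/-- The area vector `Area(P)`: the `i`-th entry is the `y`-coordinate of the starting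
point of the `i`-th up-step of `P`. -/
def areaVec (P : List ℤ) : List ℤ := areaVecAux 0 P

/-- `area(P)`: the sum of the entries of the area vector (entries of a Łukasiewicz
path are nonnegative, so taking `Int.toNat` entrywise is harmless). -/
def area (P : List ℤ) : ℕ := ((areaVec P).map Int.toNat).sum

/-- Auxiliary computation of the depth values: `cur` is the depth value of the previous
step (`0` initially), and `stack` holds the pending depth values of the future matching
down-steps (top of the stack = value for the next matching down-step to come).
Reading an up-step `U_k` whose value is `cur` (inherited from the previous step) pushes
the values `cur+1, …, cur+k` for its `k` matching down-steps (its first matching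
down-step, which crosses its topmost interior level, gets `cur+1`, etc.); reading a
down-step pops its value.  The list returned records the value `d_i` of each up-step,
from left to right. -/
def depthVecAux : ℕ → List ℕ → List ℤ → List ℕ
  | _, _, [] => []
  | cur, stack, s :: rest =>
    if 0 ≤ s then
      cur :: depthVecAux cur ((List.range s.toNat).map (fun i => cur + i + 1) ++ stack) rest
    else
      match stack with
      | [] => depthVecAux cur [] rest
      | v :: st => depthVecAux v st rest

/-- The depth vector `Depth(P)`: the values `d_i` at the up-steps of `P`, left to right. -/
def depthVec (P : List ℤ) : List ℕ := depthVecAux 0 [] P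

/-- `depth(P)`: the sum of the entries of the depth vector. -/
def depth (P : List ℤ) : ℕ := (depthVec P).sum

/-- `P ∈ 𝓛_M`. -/
def MemL (M : Multiset ℕ) (P : List ℤ) : Prop := IsLukas P ∧ profileM P = M

/-- `P ∈ 𝓛_{a,M}`: first up-step of degree `a`, profile multiset `M ⊎ {a}`. -/
def MemLa (a : ℕ) (M : Multiset ℕ) (P : List ℤ) : Prop :=
  IsLukas P ∧ firstUp? P = some a ∧ profileM P = a ::ₘ M

/-- `P ∈ 𝓛_{M,b}`: last up-step of degree `b`, profile multiset `M ⊎ {b}`. -/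
def MemLb (M : Multiset ℕ) (b : ℕ) (P : List ℤ) : Prop :=
  IsLukas P ∧ lastUp? P = some b ∧ profileM P = b ::ₘ M

/-- `P ∈ 𝓛_{a,M,b}`: first up-step of degree `a`, last up-step of degree `b`,
profile multiset `M ⊎ {a, b}`. -/
def MemLab (a : ℕ) (M : Multiset ℕ) (b : ℕ) (P : List ℤ) : Prop :=
  IsLukas P ∧ firstUp? P = some a ∧ lastUp? P = some b ∧ profileM P = a ::ₘ b ::ₘ M

/-! ## Plane-tree statistics -/

/-- The (ordered) children of the root of a plane tree. -/
def children : PTree → List PTree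
  | .node ts => ts

/-- The degree of (the root of) a plane tree: its number of children. -/
def numChildren (t : PTree) : ℕ := (children t).length

mutual
/-- Number of internal nodes of a plane tree. -/
def internCount : PTree → ℕ
  | .node [] => 0
  | .node (t :: ts) => 1 + internCountL (t :: ts)
def internCountL : List PTree → ℕ
  | [] => 0
  | t :: ts => internCount t + internCountL ts
end

mutual
/-- `lthornT T` = the sum of `lthorn(u)` over all internal nodes `u` of `T`, where
`lthorn(u)` is the number of descending edges of strict ancestors `v` of `u` lying to
the left of the path from `v` to `u`.  (Every internal node of the subtree rooted at
the `i`-th child (0-indexed) of a node gains `i` left thorns from that node.) -/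
def lthornT : PTree → ℕ
  | .node ts => lthornL 0 ts
def lthornL : ℕ → List PTree → ℕ
  | _, [] => 0
  | i, t :: ts => lthornT t + i * internCount t + lthornL (i + 1) ts
end

mutual
/-- `rthornT T` = the sum of `rthorn(u)` over all internal nodes `u` of `T`, where
`rthorn(u)` is the number of descending edges of strict ancestors `v` of `u` lying to
the right of the path from `v` to `u`. -/
def rthornT : PTree → ℕ
  | .node ts => rthornL ts
def rthornL : List PTree → ℕ
  | [] => 0
  | t :: ts => rthornT t + ts.length * internCount t + rthornL ts
end

mutual
/-- The list of the values `lthorn(u)` for the internal nodes `u` of `T`, in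
contour-walk (preorder) order. -/
def lthornList : PTree → List ℕ
  | .node [] => []
  | .node (t :: ts) => 0 :: lthornLL 0 (t :: ts)
def lthornLL : ℕ → List PTree → List ℕ
  | _, [] => []
  | i, t :: ts => (lthornList t).map (· + i) ++ lthornLL (i + 1) ts
end

mutual
/-- The list of the values `rthorn(u)` for the internal nodes `u` of `T`, in
contour-walk (preorder) order. -/
def rthornList : PTree → List ℕ
  | .node [] => []
  | .node (t :: ts) => 0 :: rthornLL (t :: ts)
def rthornLL : List PTree → List ℕ
  | [] => []
  | t :: ts => (rthornList t).map (· + ts.length) ++ rthornLL ts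
end

/-! ## The bijections `λ` and `τ` -/

mutual
/-- `λ`: record each node of the tree at its first visit in the left-to-right contour
walk: `U_k` (i.e. `k`) for an internal node with `k+1` children, `D` (i.e. `-1`)
for a leaf. -/
def lambdaT : PTree → List ℤ
  | .node ts => ((ts.length : ℤ) - 1) :: lambdaL ts
def lambdaL : List PTree → List ℤ
  | [] => []
  | t :: ts => lambdaT t ++ lambdaL ts
end

/-- Auxiliary for `τ`: reading the path from right to left, maintain the stack of the
already-built subtrees (in left-to-right order); a down-step `D` creates a leaf and an
up-step `U_k` grabs the `k+1` topmost subtrees as its children.  This builds the same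
tree as the left-to-right "leftmost bud" construction. -/
def tauStack (P : List ℤ) : List PTree :=
  P.foldr (fun s st =>
    if s < 0 then PTree.node [] :: st
    else PTree.node (st.take (s.toNat + 1)) :: st.drop (s.toNat + 1)) []

/-- `τ`: the plane tree associated with a Łukasiewicz path. -/
def tau (P : List ℤ) : PTree := (tauStack P).headD (.node [])

mutual
/-- The mirror of a plane tree: reverse the left-to-right order of the children of
every internal node. -/
def mir : PTree → PTree
  | .node ts => .node (mirL ts).reverse
def mirL : List PTree → List PTree
  | [] => []
  | t :: ts => mir t :: mirL ts
end

mutual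
/-- The subtrees rooted at the internal nodes of `T`, in contour-walk (preorder)
order. -/
def internalSubtrees : PTree → List PTree
  | .node [] => []
  | .node (t :: ts) => .node (t :: ts) :: internalSubtreesL (t :: ts)
def internalSubtreesL : List PTree → List PTree
  | [] => []
  | t :: ts => internalSubtrees t ++ internalSubtreesL ts
end

/-- The multiset of degrees of the non-root internal nodes of `T`. -/
def nonRootInternalDegs (T : PTree) : Multiset ℕ :=
  (((internalSubtreesL (children T)).map numChildren : List ℕ) : Multiset ℕ)

/-! ## Lodestars and the lodestar swap -/

/-- A node is a lodestar-type node if it is internal and all its children are leaves. -/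
def isLodestarNode (t : PTree) : Bool :=
  !(children t).isEmpty && (children t).all (fun c => (children c).isEmpty)

mutual
/-- The subtree rooted at the *left lodestar* of `T`: the first internal node, in
contour-walk (preorder) order, all of whose children are leaves (if it exists). -/
def leftLode? : PTree → Option PTree
  | .node ts =>
    if isLodestarNode (.node ts) then some (.node ts) else leftLodeL? ts
def leftLodeL? : List PTree → Option PTree
  | [] => none
  | t :: ts =>
    match leftLode? t with
    | some r => some r
    | none => leftLodeL? ts
end

mutual
/-- The subtree rooted at the *right lodestar* of `T`: the last internal node, in
contour-walk (preorder) order, all of whose children are leaves (if it exists). -/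
def rightLode? : PTree → Option PTree
  | .node ts =>
    match rightLodeL? ts with
    | some r => some r
    | none => if isLodestarNode (.node ts) then some (.node ts) else none
def rightLodeL? : List PTree → Option PTree
  | [] => none
  | t :: ts =>
    match rightLodeL? ts with
    | some r => some r
    | none => rightLode? t
end

mutual
/-- Replace the left lodestar of `T` (first preorder all-leaf-children internal node)
by the tree `r`; `none` if `T` has no internal node. -/
def replF : PTree → PTree → Option PTree
  | r, .node ts =>
    if isLodestarNode (.node ts) then some r
    else (replFL r ts).map PTree.node
def replFL : PTree → List PTree → Option (List PTree)
  | _, [] => none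
  | r, t :: ts =>
    match replF r t with
    | some t' => some (t' :: ts)
    | none => (replFL r ts).map (t :: ·)
end

mutual
/-- Replace the right lodestar of `T` (last preorder all-leaf-children internal node)
by the tree `r`; `none` if `T` has no internal node. -/
def replL : PTree → PTree → Option PTree
  | r, .node ts =>
    match replLL r ts with
    | some ts' => some (.node ts')
    | none => if isLodestarNode (.node ts) then some r else none
def replLL : PTree → List PTree → Option (List PTree)
  | _, [] => none
  | r, t :: ts =>
    match replLL r ts with
    | some ts' => some (t :: ts')
    | none => (replL r t).map (· :: ts)
end

/-- The lodestar swap: exchange the subtrees rooted at the left lodestar and the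
right lodestar of `T` (each a node together with its pendant leaves). -/
def lodeSwap (T : PTree) : PTree :=
  match leftLode? T, rightLode? T with
  | some L, some R => ((replF R T).bind (replL L)).getD T
  | _, _ => T

end Luka

namespace Luka

/-! ## Forests -/

/-- Induction on forests: a nonempty forest is a root with its forest of children,
followed by the remaining trees. -/
theorem forest_induction {p : List PTree → Prop} (nil : p [])
    (cons : ∀ ts r, p ts → p r → p (.node ts :: r)) (f : List PTree) : p f :=
  PTree.rec_1 (motive_1 := fun t => ∀ r, p r → p (t :: r)) (motive_2 := p)
    (fun ts hts r hr => cons ts r hts hr) nil (fun _ _ ht hr => ht _ hr) f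

theorem lambdaL_append (f g : List PTree) : lambdaL (f ++ g) = lambdaL f ++ lambdaL g := by
  induction f with
  | nil => simp [lambdaL]
  | cons t f ih => simp [lambdaL, ih]

theorem lambdaL_cons (ts r : List PTree) :
    lambdaL (.node ts :: r) = ((ts.length : ℤ) - 1) :: lambdaL (ts ++ r) := by
  simp [lambdaL, lambdaT, lambdaL_append]

theorem lambdaL_singleton (t : PTree) : lambdaL [t] = lambdaT t := by simp [lambdaL]

theorem mirL_eq_map (f : List PTree) : mirL f = f.map mir := by
  induction f with
  | nil => rfl
  | cons t f ih => simp [mirL, ih]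

theorem internCountL_append (f g : List PTree) :
    internCountL (f ++ g) = internCountL f + internCountL g := by
  induction f with
  | nil => simp [internCountL]
  | cons t f ih => simp [internCountL, ih, add_assoc]

theorem internCount_node {ts : List PTree} (h : ts ≠ []) :
    internCount (.node ts) = 1 + internCountL ts := by
  cases ts with
  | nil => exact absurd rfl h
  | cons t ts => rw [internCount]

theorem lthornL_append (i : ℕ) (f g : List PTree) :
    lthornL i (f ++ g) = lthornL i f + lthornL (i + f.length) g := by
  induction f generalizing i with
  | nil => simp [lthornL]
  | cons t f ih => simp [lthornL, ih, add_assoc, add_comm 1]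

/-! ## Mirror image -/

theorem mirL_mirL_reverse (f : List PTree) : (mirL (mirL f).reverse).reverse = f := by
  induction f using forest_induction with
  | nil => simp [mirL]
  | cons ts r hts hr => simpa [mirL_eq_map, mir] using ⟨by simpa [mirL_eq_map] using hts,
      by simpa [mirL_eq_map] using hr⟩

theorem mir_mir (t : PTree) : mir (mir t) = t := by
  cases t; simp [mir, mirL_mirL_reverse]

theorem internCountL_mirL_reverse (f : List PTree) :
    internCountL (mirL f).reverse = internCountL f := by
  induction f using forest_induction with
  | nil => rfl
  | cons ts r hts hr =>
    rcases eq_or_ne ts [] with rfl | h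
    · simp [mirL, internCountL_append, hr, internCountL, mir, internCount]
    · have h' : (mirL ts).reverse ≠ [] := by simpa [mirL_eq_map] using h
      simp [mirL, internCountL_append, hr, internCountL, mir, internCount_node h,
        internCount_node h', hts, add_comm]

theorem lthornL_mirL_reverse (f : List PTree) : lthornL 0 (mirL f).reverse = rthornL f := by
  induction f using forest_induction with
  | nil => rfl
  | cons ts r hts hr =>
    have hc := internCountL_mirL_reverse [.node ts]
    simp only [mirL, List.reverse_singleton, internCountL, add_zero, mir] at hc
    have hlen : (mirL r).reverse.length = r.length := by simp [mirL_eq_map]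
    rw [mirL, List.reverse_cons, lthornL_append, hr, rthornL, hlen]
    simp only [lthornL, hc, mir, lthornT, rthornT, hts]
    ring

theorem lthornT_mir (t : PTree) : lthornT (mir t) = rthornT t := by
  cases t; simp [mir, lthornT, rthornT, lthornL_mirL_reverse]

/-! ## Degrees of up-steps -/

theorem upDegs_append (P Q : List ℤ) : upDegs (P ++ Q) = upDegs P ++ upDegs Q := by
  simp [upDegs]

theorem upDegs_lambdaL_nil : upDegs (lambdaL []) = [] := rfl

theorem upDegs_lambdaL_append (f g : List PTree) :
    upDegs (lambdaL (f ++ g)) = upDegs (lambdaL f) ++ upDegs (lambdaL g) := by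
  rw [lambdaL_append, upDegs_append]

theorem upDegs_lambdaL_leaf_cons (r : List PTree) :
    upDegs (lambdaL (.node [] :: r)) = upDegs (lambdaL r) := by
  simp [lambdaL_cons, upDegs]

theorem upDegs_lambdaL_cons {ts : List PTree} (h : ts ≠ []) (r : List PTree) :
    upDegs (lambdaL (.node ts :: r)) =
      (ts.length - 1) :: (upDegs (lambdaL ts) ++ upDegs (lambdaL r)) := by
  have : 0 < ts.length := List.length_pos_iff.2 h
  rw [lambdaL_cons, ← upDegs_lambdaL_append, upDegs, List.filter_cons_of_pos (by simp; omega),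
    List.map_cons, upDegs]
  congr 1
  omega

theorem coe_upDegs_lambdaL_mirL_reverse (f : List PTree) :
    (upDegs (lambdaL (mirL f).reverse) : Multiset ℕ) = upDegs (lambdaL f) := by
  induction f using forest_induction with
  | nil => rfl
  | cons ts r hts hr =>
    rw [mirL, List.reverse_cons, upDegs_lambdaL_append, ← Multiset.coe_add, hr, mir]
    rcases eq_or_ne ts [] with rfl | h
    · simp [mirL, upDegs_lambdaL_leaf_cons, upDegs_lambdaL_nil]
    · have h' : (mirL ts).reverse ≠ [] := by simpa [mirL_eq_map] using h
      rw [upDegs_lambdaL_cons h, upDegs_lambdaL_cons h', ← Multiset.cons_coe,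
        ← Multiset.cons_coe, ← Multiset.coe_add, ← Multiset.coe_add, hts]
      simp only [mirL_eq_map, upDegs_lambdaL_nil, List.length_reverse, List.length_map,
        Multiset.coe_nil, add_zero, ← Multiset.singleton_add]
      abel

/-! ## Lodestar degrees and skeletons -/

mutual
/-- The degrees of the lodestar-type nodes (internal nodes all of whose children are
leaves) of a tree, in preorder; as for up-steps, the degree is the number of children
minus one. -/
def lodeDegs : PTree → List ℕ
  | .node [] => []
  | .node (t :: ts) =>
    if (lodeDegsL (t :: ts)).isEmpty then [ts.length] else lodeDegsL (t :: ts)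
/-- The concatenation of the lodestar degrees of the trees of a forest. -/
def lodeDegsL : List PTree → List ℕ
  | [] => []
  | t :: ts => lodeDegs t ++ lodeDegsL ts
end

mutual
/-- The skeleton of a tree: every lodestar-type node is reduced to a single child. -/
def skel : PTree → PTree
  | .node [] => .node []
  | .node (t :: ts) =>
    if (lodeDegsL (t :: ts)).isEmpty then .node [.node []] else .node (skelL (t :: ts))
/-- The skeletons of the trees of a forest. -/
def skelL : List PTree → List PTree
  | [] => []
  | t :: ts => skel t :: skelL ts
end

theorem skelL_eq_map (f : List PTree) : skelL f = f.map skel := by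
  induction f with
  | nil => rfl
  | cons t f ih => simp [skelL, ih]

theorem lodeDegsL_append (f g : List PTree) :
    lodeDegsL (f ++ g) = lodeDegsL f ++ lodeDegsL g := by
  induction f with
  | nil => simp [lodeDegsL]
  | cons t f ih => simp [lodeDegsL, ih]

theorem lodeDegs_of_eq_nil {ts : List PTree} (h : ts ≠ []) (hl : lodeDegsL ts = []) :
    lodeDegs (.node ts) = [ts.length - 1] := by
  cases ts with
  | nil => exact absurd rfl h
  | cons t ts => simp [lodeDegs, hl]

theorem lodeDegs_of_ne_nil {ts : List PTree} (hl : lodeDegsL ts ≠ []) :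
    lodeDegs (.node ts) = lodeDegsL ts := by
  cases ts with
  | nil => exact absurd rfl hl
  | cons t ts => simp [lodeDegs, hl]

theorem skel_of_eq_nil {ts : List PTree} (h : ts ≠ []) (hl : lodeDegsL ts = []) :
    skel (.node ts) = .node [.node []] := by
  cases ts with
  | nil => exact absurd rfl h
  | cons t ts => simp [skel, hl]

theorem skel_of_ne_nil {ts : List PTree} (hl : lodeDegsL ts ≠ []) :
    skel (.node ts) = .node (skelL ts) := by
  cases ts with
  | nil => exact absurd rfl hl
  | cons t ts => simp [skel, hl]

theorem lodeDegs_node_ne_nil {ts : List PTree} (h : ts ≠ []) : lodeDegs (.node ts) ≠ [] := by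
  by_cases hl : lodeDegsL ts = []
  · simp [lodeDegs_of_eq_nil h hl]
  · rwa [lodeDegs_of_ne_nil hl]

theorem lodeDegsL_replicate_leaf (n : ℕ) : lodeDegsL (List.replicate n (.node [])) = [] := by
  induction n with
  | zero => rfl
  | succ n ih => simp [List.replicate_succ, lodeDegsL, lodeDegs, ih]

theorem eq_replicate_leaf_of_lodeDegsL_eq_nil {f : List PTree} (hl : lodeDegsL f = []) :
    f = List.replicate f.length (.node []) := by
  refine List.eq_replicate_iff.2 ⟨rfl, ?_⟩
  induction f with
  | nil => simp
  | cons t f ih =>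
    obtain ⟨ts⟩ := t
    simp only [lodeDegsL, List.append_eq_nil_iff] at hl
    have : ts = [] := by
      by_contra h
      exact lodeDegs_node_ne_nil h hl.1
    subst this
    simpa using ih hl.2

theorem upDegs_lambdaL_replicate_leaf (n : ℕ) :
    upDegs (lambdaL (List.replicate n (.node []))) = [] := by
  induction n with
  | zero => rfl
  | succ n ih => rw [List.replicate_succ, upDegs_lambdaL_leaf_cons, ih]

theorem upDegs_lambdaL_of_lodeDegsL_eq_nil {f : List PTree} (hl : lodeDegsL f = []) :
    upDegs (lambdaL f) = [] := by
  rw [eq_replicate_leaf_of_lodeDegsL_eq_nil hl, upDegs_lambdaL_replicate_leaf]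

theorem internCountL_of_lodeDegsL_eq_nil {f : List PTree} (hl : lodeDegsL f = []) :
    internCountL f = 0 := by
  rw [eq_replicate_leaf_of_lodeDegsL_eq_nil hl]
  induction f.length with
  | zero => rfl
  | succ n ih => simp [List.replicate_succ, internCountL, internCount, ih]

theorem lthornL_of_lodeDegsL_eq_nil {f : List PTree} (hl : lodeDegsL f = []) (i : ℕ) :
    lthornL i f = 0 := by
  rw [eq_replicate_leaf_of_lodeDegsL_eq_nil hl]
  induction f.length generalizing i with
  | zero => rfl
  | succ n ih => simp [List.replicate_succ, lthornL, lthornT, internCount, ih]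

theorem rthornL_of_lodeDegsL_eq_nil {f : List PTree} (hl : lodeDegsL f = []) :
    rthornL f = 0 := by
  rw [eq_replicate_leaf_of_lodeDegsL_eq_nil hl]
  induction f.length with
  | zero => rfl
  | succ n ih => simp [List.replicate_succ, rthornL, rthornT, internCount, ih]

theorem length_lodeDegsL_skelL (f : List PTree) :
    (lodeDegsL (skelL f)).length = (lodeDegsL f).length := by
  induction f using forest_induction with
  | nil => rfl
  | cons ts r hts hr =>
    rw [skelL, lodeDegsL, lodeDegsL, List.length_append, List.length_append, hr]
    congr 1
    rcases eq_or_ne ts [] with rfl | h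
    · rfl
    by_cases hl : lodeDegsL ts = []
    · rw [skel_of_eq_nil h hl, lodeDegs_of_eq_nil h hl]
      rfl
    · have hl' : lodeDegsL (skelL ts) ≠ [] := by
        rwa [← List.length_pos_iff, hts, List.length_pos_iff]
      rw [skel_of_ne_nil hl, lodeDegs_of_ne_nil hl, lodeDegs_of_ne_nil hl', hts]

theorem length_lodeDegs_skel (t : PTree) : (lodeDegs (skel t)).length = (lodeDegs t).length := by
  simpa [lodeDegsL, skelL] using length_lodeDegsL_skelL [t]

theorem lodeDegsL_skelL_eq_nil_iff {f : List PTree} :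
    lodeDegsL (skelL f) = [] ↔ lodeDegsL f = [] := by
  rw [← List.length_eq_zero_iff, length_lodeDegsL_skelL, List.length_eq_zero_iff]

theorem skel_node_ne_leaf {ts : List PTree} (h : ts ≠ []) : skel (.node ts) ≠ .node [] := by
  by_cases hl : lodeDegsL ts = []
  · simp [skel_of_eq_nil h hl]
  · simpa [skel_of_ne_nil hl, skelL_eq_map] using h

/-- A forest is determined by its skeleton and its lodestar degrees. -/
theorem skelL_lodeDegsL_injective {f g : List PTree} (hs : skelL f = skelL g)
    (hd : lodeDegsL f = lodeDegsL g) : f = g := by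
  induction f using forest_induction generalizing g with
  | nil =>
    cases g with
    | nil => rfl
    | cons => simp [skelL] at hs
  | cons ts r hts hr =>
    obtain _ | ⟨⟨us⟩, r'⟩ := g
    · simp [skelL] at hs
    simp only [skelL, List.cons.injEq] at hs
    obtain ⟨hs₁, hs₂⟩ := hs
    have hlen : (lodeDegs (.node ts)).length = (lodeDegs (.node us)).length := by
      rw [← length_lodeDegs_skel, hs₁, length_lodeDegs_skel]
    obtain ⟨hd₁, hd₂⟩ := List.append_inj hd hlen
    rw [hr hs₂ hd₂]
    congr 2
    rcases eq_or_ne ts [] with rfl | ht <;> rcases eq_or_ne us [] with rfl | hu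
    · rfl
    · exact absurd hs₁.symm (skel_node_ne_leaf hu)
    · exact absurd hs₁ (skel_node_ne_leaf ht)
    have key : ∀ {vs : List PTree}, PTree.node [.node []] = .node (skelL vs) →
        lodeDegsL vs = [] := by
      intro vs h
      rw [← lodeDegsL_skelL_eq_nil_iff, ← PTree.node.inj h]
      rfl
    by_cases hlt : lodeDegsL ts = [] <;> by_cases hlu : lodeDegsL us = []
    · rw [lodeDegs_of_eq_nil ht hlt, lodeDegs_of_eq_nil hu hlu, List.cons.injEq] at hd₁
      have := List.length_pos_iff.2 ht
      have := List.length_pos_iff.2 hu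
      rw [eq_replicate_leaf_of_lodeDegsL_eq_nil hlt, eq_replicate_leaf_of_lodeDegsL_eq_nil hlu]
      congr 1
      omega
    · rw [skel_of_eq_nil ht hlt, skel_of_ne_nil hlu] at hs₁
      exact absurd (key hs₁) hlu
    · rw [skel_of_ne_nil hlt, skel_of_eq_nil hu hlu] at hs₁
      exact absurd (key hs₁.symm) hlt
    · rw [skel_of_ne_nil hlt, skel_of_ne_nil hlu] at hs₁
      rw [lodeDegs_of_ne_nil hlt, lodeDegs_of_ne_nil hlu] at hd₁
      exact hts (PTree.node.inj hs₁) hd₁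

theorem skel_lodeDegs_injective {t u : PTree} (hs : skel t = skel u)
    (hd : lodeDegs t = lodeDegs u) : t = u := by
  have := skelL_lodeDegsL_injective (f := [t]) (g := [u]) (by simp [skelL, hs])
    (by simp [lodeDegsL, hd])
  simpa using this

/-- The lodestar degrees can be prescribed arbitrarily without changing the skeleton. -/
theorem exists_skelL_eq_lodeDegsL_eq (f : List PTree) {l : List ℕ}
    (hl : l.length = (lodeDegsL f).length) : ∃ g, skelL g = skelL f ∧ lodeDegsL g = l := by
  induction f using forest_induction generalizing l with
  | nil => exact ⟨[], rfl, (List.length_eq_zero_iff.1 hl).symm⟩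
  | cons ts r hts hr =>
    rw [lodeDegsL, List.length_append] at hl
    obtain ⟨g, hg, hgl⟩ := hr (l := l.drop (lodeDegs (.node ts)).length) (by simp; omega)
    suffices ∃ u, skel u = skel (.node ts) ∧
        lodeDegs u = l.take (lodeDegs (.node ts)).length by
      obtain ⟨u, hu, hul⟩ := this
      exact ⟨u :: g, by simp [skelL, hu, hg], by simp [lodeDegsL, hul, hgl]⟩
    have hlen : (l.take (lodeDegs (.node ts)).length).length = (lodeDegs (.node ts)).length := by
      simp; omega
    generalize l.take (lodeDegs (.node ts)).length = l' at hlen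
    rcases eq_or_ne ts [] with rfl | h
    · exact ⟨.node [], rfl, (List.length_eq_zero_iff.1 hlen).symm⟩
    by_cases hn : lodeDegsL ts = []
    · rw [lodeDegs_of_eq_nil h hn] at hlen
      obtain ⟨k, rfl⟩ := List.length_eq_one_iff.1 hlen
      have hk : List.replicate (k + 1) (PTree.node []) ≠ [] := by simp
      refine ⟨.node (List.replicate (k + 1) (.node [])), ?_, ?_⟩
      · rw [skel_of_eq_nil h hn, skel_of_eq_nil hk (lodeDegsL_replicate_leaf _)]
      · simp [lodeDegs_of_eq_nil hk (lodeDegsL_replicate_leaf _)]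
    · rw [lodeDegs_of_ne_nil hn] at hlen
      obtain ⟨us, hus, rfl⟩ := hts hlen
      have hn' : lodeDegsL us ≠ [] := by
        rwa [← List.length_pos_iff, hlen, List.length_pos_iff]
      exact ⟨.node us, by rw [skel_of_ne_nil hn, skel_of_ne_nil hn', hus], lodeDegs_of_ne_nil hn'⟩

theorem lodeDegsL_mirL_reverse (f : List PTree) :
    lodeDegsL (mirL f).reverse = (lodeDegsL f).reverse := by
  induction f using forest_induction with
  | nil => rfl
  | cons ts r hts hr =>
    rw [mirL, List.reverse_cons, lodeDegsL_append, hr, mir, lodeDegsL, lodeDegsL, lodeDegsL,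
      List.append_nil, List.reverse_append]
    congr 1
    rcases eq_or_ne ts [] with rfl | h
    · rfl
    have h' : (mirL ts).reverse ≠ [] := by simpa [mirL_eq_map] using h
    by_cases hl : lodeDegsL ts = []
    · rw [lodeDegs_of_eq_nil h hl, lodeDegs_of_eq_nil h' (by simp [hts, hl])]
      simp [mirL_eq_map]
    · rw [lodeDegs_of_ne_nil hl, lodeDegs_of_ne_nil (by simpa [hts] using hl), hts]

theorem lodeDegs_mir (t : PTree) : lodeDegs (mir t) = (lodeDegs t).reverse := by
  simpa [lodeDegsL, mirL] using lodeDegsL_mirL_reverse [t]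

theorem skelL_mirL (f : List PTree) : skelL (mirL f) = mirL (skelL f) := by
  induction f using forest_induction with
  | nil => rfl
  | cons ts r hts hr =>
    rw [mirL, skelL, skelL, mirL, hr, mir]
    congr 1
    rcases eq_or_ne ts [] with rfl | h
    · rfl
    have h' : (mirL ts).reverse ≠ [] := by simpa [mirL_eq_map] using h
    by_cases hl : lodeDegsL ts = []
    · rw [skel_of_eq_nil h hl, skel_of_eq_nil h' (by simp [lodeDegsL_mirL_reverse, hl])]
      simp [mir, mirL]
    · rw [skel_of_ne_nil hl, skel_of_ne_nil (by simpa [lodeDegsL_mirL_reverse] using hl), mir,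
        ← hts, skelL_eq_map, skelL_eq_map, List.map_reverse]

theorem skel_mir (t : PTree) : skel (mir t) = mir (skel t) := by
  simpa [skelL, mirL] using skelL_mirL [t]

theorem internCountL_skelL (f : List PTree) : internCountL (skelL f) = internCountL f := by
  induction f using forest_induction with
  | nil => rfl
  | cons ts r hts hr =>
    rw [skelL, internCountL, internCountL, hr]
    congr 1
    rcases eq_or_ne ts [] with rfl | h
    · rfl
    by_cases hl : lodeDegsL ts = []
    · rw [skel_of_eq_nil h hl, internCount_node h, internCountL_of_lodeDegsL_eq_nil hl]
      rfl
    · rw [skel_of_ne_nil hl, internCount_node h, internCount_node (by simpa [skelL_eq_map]), hts]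

theorem internCount_skel (t : PTree) : internCount (skel t) = internCount t := by
  simpa [internCountL, skelL] using internCountL_skelL [t]

theorem lthornL_skelL (i : ℕ) (f : List PTree) : lthornL i (skelL f) = lthornL i f := by
  induction f using forest_induction generalizing i with
  | nil => rfl
  | cons ts r hts hr =>
    rw [skelL, lthornL, lthornL, hr, internCount_skel]
    congr 2
    rcases eq_or_ne ts [] with rfl | h
    · rfl
    by_cases hl : lodeDegsL ts = []
    · rw [skel_of_eq_nil h hl, lthornT, lthornT, lthornL_of_lodeDegsL_eq_nil hl,
        lthornL_of_lodeDegsL_eq_nil (by rfl)]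
    · rw [skel_of_ne_nil hl, lthornT, lthornT, hts]

theorem lthornT_skel (t : PTree) : lthornT (skel t) = lthornT t := by
  simpa [lthornL, skelL] using lthornL_skelL 0 [t]

theorem rthornL_skelL (f : List PTree) : rthornL (skelL f) = rthornL f := by
  induction f using forest_induction with
  | nil => rfl
  | cons ts r hts hr =>
    rw [skelL, rthornL, rthornL, hr, internCount_skel, skelL_eq_map, List.length_map]
    congr 2
    rcases eq_or_ne ts [] with rfl | h
    · rfl
    by_cases hl : lodeDegsL ts = []
    · rw [skel_of_eq_nil h hl, rthornT, rthornT, rthornL_of_lodeDegsL_eq_nil hl,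
        rthornL_of_lodeDegsL_eq_nil (by rfl)]
    · rw [skel_of_ne_nil hl, rthornT, rthornT, hts]

theorem rthornT_skel (t : PTree) : rthornT (skel t) = rthornT t := by
  simpa [rthornL, skelL] using rthornL_skelL [t]

/-- Passing to the skeleton replaces each lodestar degree by `0` in the profile. -/
theorem coe_upDegs_lambdaL_add_replicate (f : List PTree) :
    (upDegs (lambdaL f) : Multiset ℕ) + Multiset.replicate (lodeDegsL f).length 0 =
      (upDegs (lambdaL (skelL f)) : Multiset ℕ) + (lodeDegsL f : Multiset ℕ) := by
  induction f using forest_induction with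
  | nil => rfl
  | cons ts r hts hr =>
    rw [skelL, lodeDegsL, List.length_append, Multiset.replicate_add, ← Multiset.coe_add]
    rcases eq_or_ne ts [] with rfl | h
    · simpa [skel, upDegs_lambdaL_leaf_cons, lodeDegs] using hr
    rw [upDegs_lambdaL_cons h, ← Multiset.cons_coe, ← Multiset.coe_add]
    by_cases hl : lodeDegsL ts = []
    · rw [skel_of_eq_nil h hl, lodeDegs_of_eq_nil h hl, upDegs_lambdaL_of_lodeDegsL_eq_nil hl,
        upDegs_lambdaL_cons (by simp), upDegs_lambdaL_leaf_cons]
      simp only [← Multiset.singleton_add, ← Multiset.cons_coe, Multiset.coe_nil, lambdaL,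
        List.length_singleton, Multiset.replicate_one, add_zero, zero_add, upDegs,
        List.filter_nil, List.map_nil, List.nil_append, Nat.sub_self] at hr ⊢
      rw [add_assoc, add_left_comm _ {0}, hr]
      abel
    · rw [skel_of_ne_nil hl, lodeDegs_of_ne_nil hl,
        upDegs_lambdaL_cons (by simpa [skelL_eq_map]), ← Multiset.cons_coe, ← Multiset.coe_add,
        skelL_eq_map ts, List.length_map, ← skelL_eq_map, ← Multiset.singleton_add,
        ← Multiset.singleton_add, add_assoc, add_add_add_comm, hts, hr]
      abel

theorem getLast?_upDegs_lambdaL (f : List PTree) :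
    (upDegs (lambdaL f)).getLast? = (lodeDegsL f).getLast? := by
  induction f using forest_induction with
  | nil => rfl
  | cons ts r hts hr =>
    rw [lodeDegsL, List.getLast?_append, ← hr]
    rcases eq_or_ne ts [] with rfl | h
    · simp [upDegs_lambdaL_leaf_cons, lodeDegs]
    rw [upDegs_lambdaL_cons h, ← List.cons_append, List.getLast?_append]
    congr 1
    by_cases hl : lodeDegsL ts = []
    · rw [lodeDegs_of_eq_nil h hl, upDegs_lambdaL_of_lodeDegsL_eq_nil hl]
    · have hu : upDegs (lambdaL ts) ≠ [] := by
        rwa [ne_eq, ← List.getLast?_eq_none_iff, hts, List.getLast?_eq_none_iff]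
      rw [lodeDegs_of_ne_nil hl, ← hts, ← List.singleton_append, List.getLast?_append]
      cases hc : (upDegs (lambdaL ts)).getLast? with
      | none => exact absurd (List.getLast?_eq_none_iff.1 hc) hu
      | some => rfl

/-! ## Łukasiewicz paths as codes of plane trees -/

/-- All steps are at least `-1` and all nonempty suffixes have negative sum. -/
def IsForestCode : List ℤ → Prop
  | [] => True
  | s :: w => -1 ≤ s ∧ s + w.sum < 0 ∧ IsForestCode w

theorem sum_lambdaL (f : List PTree) : (lambdaL f).sum = -f.length := by
  induction f using forest_induction with
  | nil => rfl
  | cons ts r hts hr =>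
    rw [lambdaL_cons, lambdaL_append, List.sum_cons, List.sum_append, hts, hr]
    push_cast [List.length_cons]
    ring

theorem IsForestCode.lambdaL_append {w : List ℤ} (hw : IsForestCode w) (hs : w.sum ≤ 0)
    (f : List PTree) : IsForestCode (lambdaL f ++ w) := by
  induction f using forest_induction generalizing w with
  | nil => exact hw
  | cons ts r hts hr =>
    have hr' := sum_lambdaL r
    rw [lambdaL_cons, Luka.lambdaL_append, List.cons_append, List.append_assoc]
    refine ⟨by omega, ?_, hts (hr hw hs) ?_⟩
    · rw [List.sum_append, List.sum_append, sum_lambdaL, sum_lambdaL]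
      omega
    · rw [List.sum_append]
      omega

theorem isForestCode_iff {P : List ℤ} : IsForestCode P ↔
    (∀ s ∈ P, -1 ≤ s) ∧ ∀ n < P.length, (P.drop n).sum < 0 := by
  induction P with
  | nil => simp [IsForestCode]
  | cons s w ih =>
    rw [IsForestCode, ih]
    constructor
    · rintro ⟨h1, h2, h3, h4⟩
      refine ⟨by simpa using ⟨h1, h3⟩, ?_⟩
      rintro (_ | n) hn
      · simpa using h2
      · simpa using h4 n (by simpa using hn)
    · rintro ⟨h1, h2⟩
      refine ⟨h1 s (by simp), by simpa using h2 0 (by simp), fun x hx => h1 x (by simp [hx]),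
        fun n hn => by simpa using h2 (n + 1) (by simpa using hn)⟩

theorem isLukas_iff {P : List ℤ} : IsLukas P ↔ IsForestCode P ∧ P.sum = -1 := by
  have key (n : ℕ) : (P.take n).sum + (P.drop n).sum = P.sum := by
    rw [← List.sum_append, List.take_append_drop]
  rw [isForestCode_iff]
  constructor
  · rintro ⟨-, h1, h2, h3⟩
    refine ⟨⟨h1, fun n hn => ?_⟩, h3⟩
    have := key n
    have := h2 n hn
    omega
  · rintro ⟨⟨h1, h2⟩, h3⟩
    refine ⟨?_, h1, fun n hn => ?_, h3⟩
    · rintro rfl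
      simp at h3
    have := key n
    have := h2 n hn
    omega

theorem isLukas_lambdaT (t : PTree) : IsLukas (lambdaT t) := by
  rw [← lambdaL_singleton, isLukas_iff]
  refine ⟨?_, by simp [sum_lambdaL]⟩
  simpa using IsForestCode.lambdaL_append (w := []) trivial (by simp) [t]

theorem tauStack_cons (s : ℤ) (w : List ℤ) : tauStack (s :: w) =
    if s < 0 then .node [] :: tauStack w
    else .node ((tauStack w).take (s.toNat + 1)) :: (tauStack w).drop (s.toNat + 1) := rfl

theorem tauStack_lambdaL_append (f : List PTree) (w : List ℤ) :
    tauStack (lambdaL f ++ w) = f ++ tauStack w := by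
  induction f using forest_induction generalizing w with
  | nil => rfl
  | cons ts r hts hr =>
    rw [lambdaL_cons, lambdaL_append, List.cons_append, List.append_assoc, tauStack_cons, hts, hr]
    rcases eq_or_ne ts [] with rfl | h
    · simp
    have := List.length_pos_iff.2 h
    rw [if_neg (by omega), show ((ts.length : ℤ) - 1).toNat + 1 = ts.length by omega]
    simp

theorem tau_lambdaT (t : PTree) : tau (lambdaT t) = t := by
  have := tauStack_lambdaL_append [t] []
  rw [lambdaL_singleton, List.append_nil] at this
  simp [tau, this]

theorem IsForestCode.lambdaL_tauStack {P : List ℤ} (hP : IsForestCode P) :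
    lambdaL (tauStack P) = P := by
  induction P with
  | nil => rfl
  | cons s w ih =>
    obtain ⟨h1, h2, h3⟩ := hP
    have hw := sum_lambdaL (tauStack w)
    rw [ih h3] at hw
    rw [tauStack_cons]
    split_ifs with hs
    · rw [lambdaL_cons, List.nil_append, ih h3]
      simp
      omega
    · rw [lambdaL_cons, List.take_append_drop, ih h3, List.length_take]
      congr 1
      omega

theorem IsLukas.lambdaT_tau {P : List ℤ} (hP : IsLukas P) : lambdaT (tau P) = P := by
  obtain ⟨h1, h2⟩ := isLukas_iff.1 hP
  have h := h1.lambdaL_tauStack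
  have hlen := sum_lambdaL (tauStack P)
  rw [h, h2] at hlen
  obtain ⟨t, ht⟩ := List.length_eq_one_iff.1 (show (tauStack P).length = 1 by omega)
  rw [ht, lambdaL_singleton] at h
  rw [tau, ht, List.headD_cons, h]

/-! ## Area and depth in terms of thorns -/

theorem sum_areaVecAux_lambdaL_append (m : ℕ) (f : List PTree) (w : List ℤ) :
    ((areaVecAux (m + f.length - 1) (lambdaL f ++ w)).map Int.toNat).sum =
      rthornL f + m * internCountL f + ((areaVecAux (m - 1) w).map Int.toNat).sum := by
  induction f using forest_induction generalizing m w with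
  | nil => simp [lambdaL, rthornL, internCountL]
  | cons ts r hts hr =>
    rw [lambdaL_cons, lambdaL_append, List.cons_append, List.append_assoc, areaVecAux,
      List.map_append, List.sum_append,
      show (m : ℤ) + (PTree.node ts :: r).length - 1 + (ts.length - 1) =
        ((m + r.length : ℕ) : ℤ) + ts.length - 1 by push_cast [List.length_cons]; ring,
      hts, show ((m + r.length : ℕ) : ℤ) - 1 = m + r.length - 1 by push_cast; ring, hr,
      rthornL, rthornT, internCountL]
    rcases eq_or_ne ts [] with rfl | h
    · simp [internCount, internCountL]
      ring
    · have := List.length_pos_iff.2 h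
      rw [if_pos (by omega), internCount_node h]
      simp only [List.map_singleton, List.sum_singleton]
      rw [show ((m : ℤ) + (PTree.node ts :: r).length - 1).toNat = m + r.length by
        push_cast [List.length_cons]; omega]
      ring

theorem area_lambdaT (t : PTree) : area (lambdaT t) = rthornT t := by
  have := sum_areaVecAux_lambdaL_append 0 [t] []
  simpa [lambdaL_singleton, rthornL, areaVecAux, area, areaVec] using this

/-- The total left-thorn count of a forest whose roots carry the given initial values. -/
def lthornWith (l : List ℕ) (f : List PTree) : ℕ :=
  (List.zipWith (fun c t => lthornT t + c * internCount t) l f).sum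

theorem lthornWith_range' (c i : ℕ) (f : List PTree) :
    lthornWith (List.range' (c + i) f.length) f = lthornL i f + c * internCountL f := by
  induction f generalizing i with
  | nil => simp [lthornWith, lthornL, internCountL]
  | cons t f ih =>
    have := ih (i + 1)
    simp only [lthornWith] at this
    simp only [lthornWith, List.length_cons, List.range'_succ, List.zipWith_cons_cons,
      List.sum_cons, lthornL, internCountL]
    rw [add_assoc c i 1, this]
    ring

theorem lthornWith_append {l l' : List ℕ} {f f' : List PTree} (h : l.length = f.length) :
    lthornWith (l ++ l') (f ++ f') = lthornWith l f + lthornWith l' f' := by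
  rw [lthornWith, List.zipWith_append h, List.sum_append, lthornWith, lthornWith]

theorem depthVecAux_up (c : ℕ) (st : List ℕ) {s : ℤ} (hs : 0 ≤ s) (w : List ℤ) :
    depthVecAux c st (s :: w) =
      c :: depthVecAux c ((List.range s.toNat).map (fun i => c + i + 1) ++ st) w := by
  cases st <;> simp [depthVecAux, hs]

theorem depthVecAux_down (c v : ℕ) (st : List ℕ) {s : ℤ} (hs : s < 0) (w : List ℤ) :
    depthVecAux c (v :: st) (s :: w) = depthVecAux v st w := by
  simp [depthVecAux, hs]

theorem sum_depthVecAux_lambdaL (c : ℕ) (st : List ℕ) (f : List PTree)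
    (h : st.length + 1 = f.length) :
    (depthVecAux c st (lambdaL f)).sum = lthornWith (c :: st) f := by
  generalize hP : lambdaL f = P
  induction P generalizing c st f with
  | nil =>
    have := sum_lambdaL f
    rw [hP, List.sum_nil] at this
    omega
  | cons s w ih =>
    obtain _ | ⟨⟨ts⟩, r⟩ := f
    · simp at h
    rw [lambdaL_cons, List.cons.injEq] at hP
    obtain ⟨rfl, rfl⟩ := hP
    have hr : st.length = r.length := by simpa using h
    rcases eq_or_ne ts [] with rfl | hts
    · cases st with
      | nil =>
        obtain rfl := List.length_eq_zero_iff.1 hr.symm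
        simp [lambdaL, depthVecAux, lthornWith, lthornT, lthornL, internCount]
      | cons v st =>
        rw [depthVecAux_down _ _ _ (by simp), ih v st _ (by simpa using hr) rfl]
        simp [lthornWith, lthornT, lthornL, internCount]
    · have hpos := List.length_pos_iff.2 hts
      have hrange : c :: ((List.range ((ts.length : ℤ) - 1).toNat).map (fun i => c + i + 1) ++ st) =
          List.range' (c + 0) ts.length ++ st := by
        obtain ⟨n, hn⟩ : ∃ n, ts.length = n + 1 := ⟨ts.length - 1, by omega⟩
        rw [hn, List.range'_succ, List.range'_eq_map_range]
        simp [add_right_comm]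
      rw [depthVecAux_up _ _ (by omega), List.sum_cons, ih _ _ (ts ++ r) _ rfl, hrange,
        lthornWith_append (by simp), lthornWith_range']
      · simp [lthornWith, lthornT, internCount_node hts]
        ring
      · simp
        omega

theorem depth_lambdaT (t : PTree) : depth (lambdaT t) = lthornT t := by
  have := sum_depthVecAux_lambdaL 0 [] [t] rfl
  simpa [lambdaL_singleton, depth, depthVec, lthornWith] using this

/-! ## The area-depth exchanging involution -/

theorem exists_skel_eq_mir_skel (t : PTree) :
    ∃ u, skel u = mir (skel t) ∧ lodeDegs u = lodeDegs t := by
  obtain ⟨g, hg, hgl⟩ := exists_skelL_eq_lodeDegsL_eq [mir t] (l := lodeDegs t)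
    (by simp [lodeDegsL, lodeDegs_mir])
  obtain ⟨u, rfl⟩ : ∃ u, g = [u] :=
    List.length_eq_one_iff.1 (by simpa [skelL_eq_map] using congrArg List.length hg)
  exact ⟨u, by simpa [skelL, skel_mir] using hg, by simpa [lodeDegsL] using hgl⟩

/-- Mirror the skeleton of a tree, keeping the left-to-right order of lodestar degrees. -/
noncomputable def mirSkel (t : PTree) : PTree := (exists_skel_eq_mir_skel t).choose

theorem skel_mirSkel (t : PTree) : skel (mirSkel t) = mir (skel t) :=
  (exists_skel_eq_mir_skel t).choose_spec.1

theorem lodeDegs_mirSkel (t : PTree) : lodeDegs (mirSkel t) = lodeDegs t :=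
  (exists_skel_eq_mir_skel t).choose_spec.2

theorem mirSkel_mirSkel (t : PTree) : mirSkel (mirSkel t) = t :=
  skel_lodeDegs_injective (by rw [skel_mirSkel, skel_mirSkel, mir_mir])
    (by rw [lodeDegs_mirSkel, lodeDegs_mirSkel])

theorem lthornT_mirSkel (t : PTree) : lthornT (mirSkel t) = rthornT t := by
  rw [← lthornT_skel, skel_mirSkel, lthornT_mir, rthornT_skel]

theorem rthornT_mirSkel (t : PTree) : rthornT (mirSkel t) = lthornT t := by
  rw [← lthornT_mirSkel, mirSkel_mirSkel]

theorem profileM_lambdaT_mirSkel (t : PTree) :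
    profileM (lambdaT (mirSkel t)) = profileM (lambdaT t) := by
  have h₁ := coe_upDegs_lambdaL_add_replicate [t]
  have h₂ := coe_upDegs_lambdaL_add_replicate [mirSkel t]
  have h₃ := coe_upDegs_lambdaL_mirL_reverse [skel t]
  simp only [skelL, lodeDegsL, List.append_nil, lodeDegs_mirSkel, skel_mirSkel] at h₁ h₂
  simp only [mirL, List.reverse_singleton] at h₃
  rw [h₃, ← h₁] at h₂
  simpa only [lambdaL_singleton, profileM] using add_right_cancel h₂

theorem lastUp?_lambdaT (t : PTree) : lastUp? (lambdaT t) = (lodeDegs t).getLast? := by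
  rw [lastUp?, ← lambdaL_singleton, getLast?_upDegs_lambdaL, lodeDegsL, lodeDegsL,
    List.append_nil]

theorem lastUp?_lambdaT_mirSkel (t : PTree) :
    lastUp? (lambdaT (mirSkel t)) = lastUp? (lambdaT t) := by
  rw [lastUp?_lambdaT, lastUp?_lambdaT, lodeDegs_mirSkel]

theorem firstUp?_lambdaT (t : PTree) (h : 2 ≤ (profileM (lambdaT t)).card) :
    firstUp? (lambdaT t) = some (numChildren (skel t) - 1) := by
  obtain ⟨ts⟩ := t
  rw [firstUp?]
  rw [profileM, Multiset.coe_card] at h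
  rw [← lambdaL_singleton] at h ⊢
  rcases eq_or_ne ts [] with rfl | hts
  · simp [upDegs_lambdaL_leaf_cons, upDegs_lambdaL_nil] at h
  rw [upDegs_lambdaL_cons hts] at h ⊢
  have hl : lodeDegsL ts ≠ [] := by
    intro hl
    simp [upDegs_lambdaL_of_lodeDegsL_eq_nil hl, upDegs_lambdaL_nil] at h
  simp [skel_of_ne_nil hl, numChildren, children, skelL_eq_map]

theorem numChildren_mir (t : PTree) : numChildren (mir t) = numChildren t := by
  cases t; simp [mir, numChildren, children, mirL_eq_map]

theorem MemLab.lambdaT_mirSkel {a b : ℕ} {M : Multiset ℕ} {t : PTree}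
    (h : MemLab a M b (lambdaT t)) : MemLab a M b (lambdaT (mirSkel t)) := by
  obtain ⟨-, h₁, h₂, h₃⟩ := h
  have hc : 2 ≤ (profileM (lambdaT t)).card := by simp [h₃]
  have hc' := hc
  rw [← profileM_lambdaT_mirSkel] at hc'
  refine ⟨isLukas_lambdaT _, ?_, by rw [lastUp?_lambdaT_mirSkel, h₂],
    by rw [profileM_lambdaT_mirSkel, h₃]⟩
  rw [firstUp?_lambdaT _ hc', skel_mirSkel, numChildren_mir, ← firstUp?_lambdaT _ hc, h₁]

end Luka

open Luka in
/-- **Theorem 1.1 ([QZ25, Conjecture 1.4]).**  For any naturals `a, b` and any finite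
multiset `M` of naturals, the polynomial
`C̃_{a,M,b}(q,t) = Σ_{P ∈ 𝓛_{a,M,b}} q^{area(P)} t^{depth(P)}` is symmetric in `q, t`.
The finite set `𝓛_{a,M,b}` is presented as an arbitrary `Finset S` whose members are
exactly the Łukasiewicz paths with first up-step of degree `a`, last up-step of degree
`b`, and profile multiset `M ⊎ {a,b}`; symmetry in `q, t` is expressed by evaluating at
arbitrary elements `q, t` of an arbitrary commutative semiring. -/
theorem tildeC_aMb_qt_symm (a b : ℕ) (M : Multiset ℕ) {R : Type*} [CommSemiring R]
    (q t : R) (S : Finset (List ℤ)) (hS : ∀ P, P ∈ S ↔ MemLab a M b P) :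
    ∑ P ∈ S, q ^ area P * t ^ depth P = ∑ P ∈ S, t ^ area P * q ^ depth P := by
  have hτ (P) (hP : P ∈ S) : lambdaT (tau P) = P := ((hS P).1 hP).1.lambdaT_tau
  have hmem (P) (hP : P ∈ S) : lambdaT (mirSkel (tau P)) ∈ S := by
    rw [hS]
    exact MemLab.lambdaT_mirSkel (by rw [hτ P hP, ← hS]; exact hP)
  have hinv (P) (hP : P ∈ S) :
      lambdaT (mirSkel (tau (lambdaT (mirSkel (tau P))))) = P := by
    rw [tau_lambdaT, mirSkel_mirSkel, hτ P hP]
  refine Finset.sum_nbij' (fun P => lambdaT (mirSkel (tau P)))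
    (fun P => lambdaT (mirSkel (tau P))) hmem hmem hinv hinv fun P hP => ?_
  have h := hτ P hP
  generalize tau P = T at h ⊢
  subst h
  rw [area_lambdaT, area_lambdaT, depth_lambdaT, depth_lambdaT, lthornT_mirSkel,
    rthornT_mirSkel, mul_comm]
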